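/- Let q∈(q_KL,3). Then the set D_q = {dim_H(E∩(E+t)) : t∈T} contains a nondegenerate interval, where dim_H denotes Hausdorff dimension and E+t={x+t : x∈E}. -/

import Mathlib

open scoped Pointwise ENNReal
open Filter

noncomputable section

/-- The digit set Ω₁ = {(0,0),(0,1),(1,0)} ⊆ ℝ². -/
def Omega1 : Set (ℝ × ℝ) := {((0:ℝ), (0:ℝ)), (0, 1), (1, 0)}

/-- The digit set Ω₂ = Ω₁ − Ω₁ ⊆ ℝ². -/
def Omega2 : Set (ℝ × ℝ) :=
  {((0:ℝ), (0:ℝ)), (0, 1), (1, 0), (-1, 0), (-1, 1), (0, -1), (1, -1)}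

/-- The Sierpinski gasket in base `q`. -/
def gasket (q : ℝ) : Set (ℝ × ℝ) :=
  {x | ∃ c : ℕ → ℝ × ℝ, (∀ i, c i ∈ Omega1) ∧ x = ∑' i, (q ^ (i + 1))⁻¹ • c i}

/-- `U_q`: points of `[-1/(q-1), 1/(q-1)]` having a unique `q`-expansion over `{-1,0,1}`. -/
def uniqSet (q : ℝ) : Set ℝ :=
  {s | s ∈ Set.Icc (-(1 / (q - 1))) (1 / (q - 1)) ∧
    ∃! t : ℕ → ℝ, (∀ i, t i ∈ ({-1, 0, 1} : Set ℝ)) ∧ s = ∑' i, t i / q ^ (i + 1)}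

/-- The set `T`. -/
def Tset (q : ℝ) : Set (ℝ × ℝ) :=
  {t | t ∈ gasket q - gasket q ∧ t.1 ∈ uniqSet q ∧ t.2 ∈ uniqSet q}

/-- The set `D_q` of Hausdorff dimensions of intersections. -/
def Dset (q : ℝ) : Set ℝ≥0∞ :=
  {d | ∃ t ∈ Tset q, d = dimH (gasket q ∩ ((· + t) '' gasket q))}

/-- The words `w_n` over `{0,1,2}`: `klWord 0 = w₁ = 2`,
`w_{n+1} = (w_n ⟨reflection of w_n⟩)⁺`. -/
def klWord : ℕ → List ℕ
  | 0 => [2]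
  | n + 1 =>
    let w := klWord n ++ (klWord n).map (fun x => 2 - x)
    w.dropLast ++ [w.getLast?.getD 0 + 1]

/-- `isKLBase n p`: `p ∈ (2,3)` and `1` has (greedy) expansion `w_n 0^∞` in base `p`
w.r.t. `{0,1,2}`, i.e. `p = q_n`. -/
def isKLBase (n : ℕ) (p : ℝ) : Prop :=
  p ∈ Set.Ioo (2 : ℝ) 3 ∧
    (1 : ℝ) = ∑ i ∈ Finset.range (klWord (n - 1)).length,
      ((klWord (n - 1)).getD i 0 : ℝ) / p ^ (i + 1)

/-- `1` has a unique expansion in base `p` w.r.t. the digit set `{0,1,2}`. -/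
def uniqueOneExp (p : ℝ) : Prop :=
  ∃! c : ℕ → ℕ, (∀ i, c i ≤ 2) ∧ (1 : ℝ) = ∑' i, (c i : ℝ) / p ^ (i + 1)

/-- The Thue–Morse sequence. -/
def tm : ℕ → ℕ
  | 0 => 0
  | n + 1 => if (n + 1) % 2 = 0 then tm ((n + 1) / 2) else 1 - tm ((n + 1) / 2)
decreasing_by all_goals omega

/-- `λ_i = τ_i − τ_{i−1}` (for `i ≥ 1`). -/
def lam (i : ℕ) : ℤ := (tm i : ℤ) - (tm (i - 1) : ℤ)

/-- The word `ε_n = λ₁ ⋯ λ_{2^n}`. -/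
def eps (n : ℕ) : List ℤ := (List.range (2 ^ n)).map fun i => lam (i + 1)

/-- Reflection of a word over `{-1,0,1}`: each digit `x` is replaced by `-x`. -/
def reflect (w : List ℤ) : List ℤ := w.map fun x => -x

/-- `w⁺`: the last digit is increased by `1`. -/
def plusOne (w : List ℤ) : List ℤ := w.dropLast ++ [w.getLast?.getD 0 + 1]

/-- `w⁻`: the last digit is decreased by `1`. -/
def minusOne (w : List ℤ) : List ℤ := w.dropLast ++ [w.getLast?.getD 0 - 1]

/-- The periodic sequence `w^∞` (the `(j+1)`-st term is `per w j`). -/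
def per (w : List ℤ) : ℕ → ℤ := fun j => w.getD (j % w.length) 0

/-- `EndsWith x s`: the sequence `x` ends with (has tail) the sequence `s`. -/
def EndsWith {α : Type*} (x s : ℕ → α) : Prop := ∃ k, ∀ j, x (j + k) = s j

/-- The digit set Ω₂ as a subset of ℤ × ℤ. -/
def Omega2Z : Set (ℤ × ℤ) :=
  {((0:ℤ), (0:ℤ)), (0, 1), (1, 0), (-1, 0), (-1, 1), (0, -1), (1, -1)}

/-- `E_{n,m}^i = (σ^i((ε_n ε̄_n)^∞), (ε_m ε̄_m)^∞)` (the `(j+1)`-st term is `Eseq n m i j`). -/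
def Eseq (n m i : ℕ) : ℕ → ℤ × ℤ := fun j =>
  (per (eps n ++ reflect (eps n)) (j + i), per (eps m ++ reflect (eps m)) j)


/-- `A_k = a₁ ⋯ a_{2^k}` where `a_i = λ_{2i−1}`. -/
def Aword (k : ℕ) : List ℤ := (List.range (2 ^ k)).map fun i => lam (2 * i + 1)

/-- `D_{k,k}^i = (σ^i((A_k Ā_k)^∞), (A_k Ā_k)^∞)`. -/
def Dseq (k i : ℕ) : ℕ → ℤ × ℤ := fun j =>
  (per (Aword k ++ reflect (Aword k)) (j + i), per (Aword k ++ reflect (Aword k)) j)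

/-- `U_q'`: the set of sequences over `{-1,0,1}` which are the unique `q`-expansion
of the number they represent. -/
def uniqSeqSet (q : ℝ) : Set (ℕ → ℤ) :=
  {t | (∀ i, t i ∈ ({-1, 0, 1} : Set ℤ)) ∧
    ∀ s : ℕ → ℤ, (∀ i, s i ∈ ({-1, 0, 1} : Set ℤ)) →
      (∑' i, (s i : ℝ) / q ^ (i + 1)) = (∑' i, (t i : ℝ) / q ^ (i + 1)) → s = t}

/-- `ε_{n-1} ε̄_{n-1}`, with the convention `ε_{-1} ε̄_{-1} := 00`. -/
def epsPair : ℕ → List ℤ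
  | 0 => [0, 0]
  | n + 1 => eps n ++ reflect (eps n)

/-- The finite prefix
`(ε_0 ε̄_0)^{j_0} (ε_0 ε̄_1)^{l_0} ⋯ (ε_{M-1} ε̄_{M-1})^{j_{M-1}} (ε_{M-1} ε̄_M)^{l_{M-1}}`. -/
def blockJL (j l : ℕ → ℕ) : ℕ → List ℤ
  | 0 => []
  | M + 1 => blockJL j l M
      ++ (List.replicate (j M) (eps M ++ reflect (eps M))).flatten
      ++ (List.replicate (l M) (eps M ++ reflect (eps (M + 1)))).flatten

/-- The tail of `t` starting at some position `k` follows the pattern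
`(ε_0 ε̄_0)^{j_0}(ε_0 ε̄_1)^{l_0}(ε_1 ε̄_1)^{j_1}(ε_1 ε̄_2)^{l_1}⋯`. -/
def TailFollows (t : ℕ → ℤ) (j l : ℕ → ℕ) : Prop :=
  ∃ k, ∀ M, ∀ i < (blockJL j l M).length, t (i + k) = (blockJL j l M).getD i 0

/-- As `TailFollows`, but for the reflection of the pattern. -/
def TailFollowsRefl (t : ℕ → ℤ) (j l : ℕ → ℕ) : Prop :=
  ∃ k, ∀ M, ∀ i < (blockJL j l M).length, t (i + k) = -(blockJL j l M).getD i 0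

/-- `a_n = 0 λ₁ ⋯ λ_{2^n−1}`. -/
def aword (n : ℕ) : List ℤ := 0 :: ((List.range (2 ^ n - 1)).map fun i => lam (i + 1))

/-- `b_n = (−1) λ₁ ⋯ λ_{2^n−1}`. -/
def bword (n : ℕ) : List ℤ := (-1) :: ((List.range (2 ^ n - 1)).map fun i => lam (i + 1))

/-- The transitions allowed by the matrix `A` on the alphabet `{a_n, b_n, ā_n, b̄_n}`:
`a→b, a→ā, b→ā, ā→a, ā→b̄, b̄→a`. -/
def allowedTrans (n : ℕ) (u v : List ℤ) : Prop :=
  (u = aword n ∧ (v = bword n ∨ v = reflect (aword n))) ∨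
  (u = bword n ∧ v = reflect (aword n)) ∨
  (u = reflect (aword n) ∧ (v = aword n ∨ v = reflect (bword n))) ∨
  (u = reflect (bword n) ∧ v = aword n)


/-- The value `∑ s_i / q^{i+1}` of a sequence of integer digits in base `q`. -/
def val (q : ℝ) (s : ℕ → ℤ) : ℝ := ∑' i, (s i : ℝ) / q ^ (i + 1)

/-- Sequences over the alphabet `{-1,0,1}`. -/
def IsDig (s : ℕ → ℤ) : Prop := ∀ i, |s i| ≤ 1

lemma hasSum_geom_div {q : ℝ} (hq : 1 < q) (M : ℝ) :
    HasSum (fun i : ℕ => M / q ^ (i + 1)) (M / (q - 1)) := by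
  have h := (hasSum_geometric_of_lt_one (r := q⁻¹) (by positivity)
    (inv_lt_one_of_one_lt₀ hq)).mul_left (M / q)
  have e : M / q * (1 - q⁻¹)⁻¹ = M / (q - 1) := by
    have : q - 1 ≠ 0 := by linarith
    have : q ≠ 0 := by linarith
    field_simp
  rw [e] at h
  refine h.congr_fun fun i => ?_
  rw [pow_succ', ← div_div, div_eq_mul_inv (M / q), inv_pow]

lemma summable_val {q : ℝ} (hq : 1 < q) {M : ℝ} {s : ℕ → ℤ} (hs : ∀ i, |(s i : ℝ)| ≤ M) :
    Summable (fun i => (s i : ℝ) / q ^ (i + 1)) := by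
  refine Summable.of_norm_bounded (hasSum_geom_div hq M).summable fun i => ?_
  rw [norm_div, Real.norm_eq_abs, Real.norm_of_nonneg (by positivity)]
  gcongr
  exact hs i

lemma abs_val_le {q : ℝ} (hq : 1 < q) {M : ℝ} {s : ℕ → ℤ} (hs : ∀ i, |(s i : ℝ)| ≤ M) :
    |val q s| ≤ M / (q - 1) := by
  rw [← Real.norm_eq_abs]
  refine tsum_of_norm_bounded (hasSum_geom_div hq M) fun i => ?_
  rw [norm_div, Real.norm_eq_abs, Real.norm_of_nonneg (by positivity)]
  gcongr
  exact hs i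

lemma val_succ {q : ℝ} (hq : 1 < q) {M : ℝ} {s : ℕ → ℤ} (hs : ∀ i, |(s i : ℝ)| ≤ M) :
    val q s = (s 0 + val q (fun i => s (i + 1))) / q := by
  unfold val
  rw [(summable_val hq hs).tsum_eq_zero_add, add_div, ← tsum_div_const]
  congr 1
  · simp
  · refine tsum_congr fun i => ?_
    rw [pow_succ q (i + 1), div_div]

lemma val_neg (q : ℝ) (s : ℕ → ℤ) : val q (fun i => -s i) = -val q s := by
  unfold val
  rw [← tsum_neg]
  refine tsum_congr fun i => ?_
  push_cast
  ring

lemma val_sub {q : ℝ} (hq : 1 < q) {M M' : ℝ} {s s' : ℕ → ℤ} (hs : ∀ i, |(s i : ℝ)| ≤ M)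
    (hs' : ∀ i, |(s' i : ℝ)| ≤ M') :
    val q (fun i => s i - s' i) = val q s - val q s' := by
  unfold val
  rw [← (summable_val hq hs).tsum_sub (summable_val hq hs')]
  refine tsum_congr fun i => ?_
  push_cast
  ring

lemma val_eq_tail {q : ℝ} (hq : 1 < q) {M : ℝ} {s : ℕ → ℤ} (hs : ∀ i, |(s i : ℝ)| ≤ M)
    (n : ℕ) (h0 : ∀ i < n, s i = 0) :
    val q s = val q (fun i => s (n + i)) / q ^ n := by
  induction n generalizing s with
  | zero => simp
  | succ n ih =>
    rw [val_succ hq hs, ih (fun i => hs (i + 1)) (fun i hi => h0 _ (by omega)),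
      h0 0 (by omega), pow_succ, Int.cast_zero, zero_add, div_div]
    simp only [add_right_comm]

lemma IsDig.abs_le {s : ℕ → ℤ} (hs : IsDig s) (i : ℕ) : |(s i : ℝ)| ≤ 1 := by
  exact_mod_cast hs i

lemma IsDig.shift {s : ℕ → ℤ} (hs : IsDig s) (n : ℕ) : IsDig (fun i => s (n + i)) :=
  fun i => hs (n + i)

lemma IsDig.neg {s : ℕ → ℤ} (hs : IsDig s) : IsDig (fun i => -s i) :=
  fun i => by simpa using hs i

lemma IsDig.abs_sub_le {s s' : ℕ → ℤ} (hs : IsDig s) (hs' : IsDig s') (i : ℕ) :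
    |((s i - s' i : ℤ) : ℝ)| ≤ 2 := by
  have h1 := _root_.abs_le.1 (hs i)
  have h2 := _root_.abs_le.1 (hs' i)
  have : |s i - s' i| ≤ 2 := _root_.abs_le.2 (by omega)
  exact_mod_cast this

/-- Comparison of the values of two sequences through their first difference. -/
lemma val_sub_val {q : ℝ} (hq : 1 < q) {s s' : ℕ → ℤ} (hs : IsDig s) (hs' : IsDig s')
    (n : ℕ) (h0 : ∀ i < n, s i = s' i) :
    val q s - val q s' = (s n - s' n + val q (fun i => s (n + 1 + i))
      - val q (fun i => s' (n + 1 + i))) / q ^ (n + 1) := by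
  rw [← val_sub hq hs.abs_le hs'.abs_le,
    val_eq_tail hq (hs.abs_sub_le hs') n (fun i hi => by simp [h0 i hi]),
    val_succ hq (fun i => hs.abs_sub_le hs' (n + i)), pow_succ', ← div_div]
  congr 2
  have := val_sub hq (hs.shift (n + 1)).abs_le (hs'.shift (n + 1)).abs_le
  have e : (fun i => s (n + (i + 1)) - s' (n + (i + 1))) =
      fun i => s (n + 1 + i) - s' (n + 1 + i) := by
    funext i
    rw [show n + (i + 1) = n + 1 + i by omega]
  rw [e, this]
  push_cast
  simp only [add_zero]
  ring

lemma exists_val_eq {p x : ℝ} (hp : 1 < p) (hp3 : p ≤ 3) (hx : |x| ≤ 1 / (p - 1)) :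
    ∃ s, IsDig s ∧ val p s = x := by
  have hp1 : 0 < p - 1 := by linarith
  have key : ∀ y : ℝ, |y| ≤ 1 / (p - 1) → ∃ d : ℤ, |d| ≤ 1 ∧ |p * y - d| ≤ 1 / (p - 1) := by
    intro y hy
    rw [abs_le] at hy
    set B := 1 / (p - 1) with hB
    have hB1 : p * B = B + 1 := by rw [hB]; field_simp; ring
    have hB2 : 1 / 2 ≤ B := by rw [hB]; gcongr; linarith
    have h1 : p * y ≤ B + 1 := by rw [← hB1]; gcongr; exact hy.2
    have h2 : -(B + 1) ≤ p * y := by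
      rw [← hB1, ← mul_neg]; gcongr; exact hy.1
    by_cases c1 : B < p * y
    · exact ⟨1, by norm_num, abs_le.2 ⟨by push_cast; linarith, by push_cast; linarith⟩⟩
    · by_cases c2 : p * y < -B
      · exact ⟨-1, by norm_num, abs_le.2 ⟨by push_cast; linarith, by push_cast; linarith⟩⟩
      · exact ⟨0, by norm_num, abs_le.2 ⟨by push_cast; linarith, by push_cast; linarith⟩⟩
  choose! d hd1 hd2 using key
  let r : ℕ → ℝ := fun n => (fun y => p * y - d y)^[n] x
  have hr : ∀ n, r (n + 1) = p * r n - d (r n) := fun n => Function.iterate_succ_apply' _ _ _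
  have hrb : ∀ n, |r n| ≤ 1 / (p - 1) := by
    intro n
    induction n with
    | zero => exact hx
    | succ n ih => rw [hr]; exact hd2 _ ih
  have hs : IsDig (fun n => d (r n)) := fun n => hd1 _ (hrb n)
  refine ⟨fun n => d (r n), hs, ?_⟩
  have hpart : ∀ n, ∑ i ∈ Finset.range n, (d (r i) : ℝ) / p ^ (i + 1) = x - r n / p ^ n := by
    intro n
    induction n with
    | zero => simp [r]
    | succ n ih =>
      rw [Finset.sum_range_succ, ih, hr]
      field_simp
      ring
  have h1 := (summable_val hp hs.abs_le).hasSum.tendsto_sum_nat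
  have h2 : Tendsto (fun n => x - r n / p ^ n) atTop (nhds (x - 0)) := by
    refine tendsto_const_nhds.sub ?_
    have h3 : Tendsto (fun n : ℕ => (1 / (p - 1)) * (p⁻¹) ^ n) atTop (nhds (1 / (p - 1) * 0)) :=
      (tendsto_pow_atTop_nhds_zero_of_lt_one (by positivity)
        (inv_lt_one_of_one_lt₀ hp)).const_mul _
    rw [mul_zero] at h3
    refine squeeze_zero_norm (fun n => ?_) h3
    rw [norm_div, Real.norm_eq_abs, Real.norm_of_nonneg (by positivity), inv_pow, div_eq_mul_inv]
    gcongr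
    exact hrb n
  simp only [hpart] at h1
  rw [sub_zero] at h2
  exact tendsto_nhds_unique h1 h2

lemma exists_first_diff {s s' : ℕ → ℤ} (h : s ≠ s') : ∃ k, (∀ i < k, s i = s' i) ∧ s k ≠ s' k := by
  classical
  have hex : ∃ k, s k ≠ s' k := Function.ne_iff.1 h
  exact ⟨Nat.find hex, fun i hi => not_not.1 (Nat.find_min hex hi), Nat.find_spec hex⟩

/-- `γ` is the only expansion of its value in base `p`. -/
def IsUnivoque (p : ℝ) (γ : ℕ → ℤ) : Prop :=
  IsDig γ ∧ ∀ s, IsDig s → val p s = val p γ → s = γ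

lemma IsUnivoque.neg {p : ℝ} {γ : ℕ → ℤ} (h : IsUnivoque p γ) :
    IsUnivoque p (fun i => -γ i) := by
  refine ⟨h.1.neg, fun s hs he => ?_⟩
  have := h.2 _ hs.neg (by rw [val_neg, he, val_neg, neg_neg])
  funext i
  have := congrFun this i
  omega

lemma IsUnivoque.val_tail_lt {p : ℝ} (hp : 1 < p) (hp3 : p ≤ 3) {γ : ℕ → ℤ}
    (h : IsUnivoque p γ) {n : ℕ} (hn : γ n < 1) :
    val p (fun i => γ (n + 1 + i)) < 1 - 1 / (p - 1) := by
  by_contra! hc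
  have hb := abs_le.1 (abs_val_le hp (h.1.shift (n + 1)).abs_le)
  have hp1 : 0 < 1 / (p - 1) := by
    have : 0 < p - 1 := by linarith
    positivity
  obtain ⟨s, hs, hsv⟩ := exists_val_eq hp hp3 (x := val p (fun i => γ (n + 1 + i)) - 1)
    (abs_le.2 ⟨by linarith, by linarith⟩)
  let s' : ℕ → ℤ := fun i => if i < n then γ i else if i = n then γ n + 1 else s (i - (n + 1))
  have hs' : IsDig s' := by
    intro i
    simp only [s']
    split_ifs
    · exact h.1 i
    · have := abs_le.1 (h.1 n)
      exact abs_le.2 (by omega)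
    · exact hs _
  have hd := val_sub_val hp hs' h.1 n (fun i hi => by simp [s', hi])
  have e1 : (fun i => s' (n + 1 + i)) = s := by
    funext i
    simp only [s']
    rw [if_neg (by omega), if_neg (by omega)]
    congr 1
    omega
  have e2 : s' n = γ n + 1 := by simp [s']
  rw [e1, hsv, e2] at hd
  have h0 : val p s' - val p γ = 0 := by
    rw [hd]; push_cast; ring
  have := congrFun (h.2 s' hs' (by linarith)) n
  omega

lemma IsUnivoque.lt_val_tail {p : ℝ} (hp : 1 < p) (hp3 : p ≤ 3) {γ : ℕ → ℤ}
    (h : IsUnivoque p γ) {n : ℕ} (hn : -1 < γ n) :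
    -(1 - 1 / (p - 1)) < val p (fun i => γ (n + 1 + i)) := by
  have := h.neg.val_tail_lt hp hp3 (n := n) (by omega)
  rw [val_neg p (fun i => γ (n + 1 + i))] at this
  linarith

/-- In base `p`, the order of the values is the lexicographic order near univoque sequences. -/
lemma IsUnivoque.val_lt_val {p : ℝ} (hp : 1 < p) (hp3 : p ≤ 3) {γ s : ℕ → ℤ}
    (h : IsUnivoque p γ) (hs : IsDig s) {k : ℕ} (he : ∀ i < k, s i = γ i) (hk : s k < γ k) :
    val p s < val p γ := by
  have hd := val_sub_val hp hs h.1 k he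
  have h1 := (abs_le.1 (hs k)).1
  have h2 := h.lt_val_tail hp hp3 (n := k) (by omega)
  have h3 := (abs_le.1 (abs_val_le hp (hs.shift (k + 1)).abs_le)).2
  have h4 : (s k : ℝ) + 1 ≤ γ k := by exact_mod_cast hk
  have : val p s - val p γ < 0 := by
    rw [hd]
    exact div_neg_of_neg_of_pos (by linarith) (by positivity)
  linarith

lemma IsUnivoque.val_lt_val' {p : ℝ} (hp : 1 < p) (hp3 : p ≤ 3) {γ s : ℕ → ℤ}
    (h : IsUnivoque p γ) (hs : IsDig s) {k : ℕ} (he : ∀ i < k, s i = γ i) (hk : γ k < s k) :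
    val p γ < val p s := by
  have := h.neg.val_lt_val hp hp3 hs.neg (k := k) (fun i hi => by rw [he i hi]) (by omega)
  rw [val_neg, val_neg] at this
  linarith

lemma exists_isUnivoque {p : ℝ} (hp : 1 < p) (h : uniqueOneExp p) :
    ∃ γ, IsUnivoque p γ ∧ val p γ = 1 - 1 / (p - 1) := by
  have hone : ∀ c : ℕ → ℤ, IsDig c →
      ∑' i, ((c i + 1 : ℤ) : ℝ) / p ^ (i + 1) = val p c + 1 / (p - 1) := by
    intro c hc
    rw [val, ← (hasSum_geom_div hp 1).tsum_eq,
      ← (summable_val hp hc.abs_le).tsum_add (hasSum_geom_div hp 1).summable]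
    refine tsum_congr fun i => ?_
    push_cast
    ring
  obtain ⟨c, ⟨hc, hc1⟩, hu⟩ := h
  have hγ : IsDig (fun i => (c i : ℤ) - 1) := fun i => abs_le.2 (by have := hc i; dsimp only; omega)
  have hv : val p (fun i => (c i : ℤ) - 1) = 1 - 1 / (p - 1) := by
    have := hone _ hγ
    simp only [sub_add_cancel, Int.cast_natCast] at this
    linarith
  refine ⟨fun i => (c i : ℤ) - 1, ⟨hγ, fun s hs he => ?_⟩, hv⟩
  have hs0 : ∀ i, 0 ≤ s i + 1 ∧ s i + 1 ≤ 2 := fun i => by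
    have := abs_le.1 (hs i)
    omega
  have := hu (fun i => (s i + 1).toNat) ⟨fun i => by have := hs0 i; dsimp only; omega, by
    have e : ∀ i, (((s i + 1).toNat : ℕ) : ℝ) = ((s i + 1 : ℤ) : ℝ) := fun i => by
      exact_mod_cast congrArg (Int.cast (R := ℝ)) (Int.toNat_of_nonneg (hs0 i).1)
    simp only [e]
    rw [hone s hs, he, hv]
    ring⟩
  funext i
  have h1 := congrFun this i
  have := hs0 i
  omega

lemma one_sub_pos_of_isUnivoque {p : ℝ} (hp : 1 < p) (hp3 : p ≤ 3) {γ : ℕ → ℤ}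
    (h : IsUnivoque p γ) (hv : val p γ = 1 - 1 / (p - 1)) : 0 < 1 - 1 / (p - 1) := by
  have hs := val_succ hp h.1.abs_le
  rw [hv, eq_div_iff (by linarith)] at hs
  have h0 := abs_le.1 (h.1 0)
  have e : (fun i => γ (0 + 1 + i)) = fun i => γ (i + 1) := by
    funext i
    rw [zero_add, add_comm]
  have hp1 : (1 - 1 / (p - 1)) * (p - 1) = p - 2 := by
    have : p - 1 ≠ 0 := by linarith
    field_simp
    ring
  have h1 := h.val_tail_lt hp hp3 (n := 0)
  have h2 := h.lt_val_tail hp hp3 (n := 0)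
  rw [e] at h1 h2
  obtain c | c | c : γ 0 = -1 ∨ γ 0 = 0 ∨ γ 0 = 1 := by omega
  · have := h1 (by omega)
    rw [c] at hs
    push_cast at hs
    nlinarith
  · have := h1 (by omega)
    have := h2 (by omega)
    linarith
  · have := h2 (by omega)
    rw [c] at hs
    push_cast at hs
    by_contra! hc
    nlinarith

lemma tm_two_mul (n : ℕ) : tm (2 * n) = tm n := by
  cases n with
  | zero => rfl
  | succ n =>
    rw [show 2 * (n + 1) = (2 * n + 1) + 1 by ring, tm, if_pos (by omega)]
    congr 1
    omega

lemma tm_two_mul_add_one (n : ℕ) : tm (2 * n + 1) = 1 - tm n := by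
  rw [tm, if_neg (by omega)]
  congr 2
  omega

lemma tm_le_one (n : ℕ) : tm n ≤ 1 := by
  induction n using Nat.strong_induction_on with
  | _ n ih =>
    obtain ⟨m, rfl | rfl⟩ := Nat.even_or_odd' n
    · rcases Nat.eq_zero_or_pos m with rfl | hm
      · rw [mul_zero, tm]; omega
      · rw [tm_two_mul]; exact ih m (by omega)
    · rw [tm_two_mul_add_one]; omega

lemma tm_pow_add (n : ℕ) : ∀ i < 2 ^ n, tm (2 ^ n + i) = 1 - tm i := by
  induction n with
  | zero =>
    intro i hi
    obtain rfl : i = 0 := by simpa using hi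
    have := tm_two_mul_add_one 0
    simpa using this
  | succ n ih =>
    intro i hi
    rw [pow_succ] at hi ⊢
    obtain ⟨m, rfl | rfl⟩ := Nat.even_or_odd' i
    · rw [show 2 ^ n * 2 + 2 * m = 2 * (2 ^ n + m) by ring, tm_two_mul, tm_two_mul, ih m (by omega)]
    · rw [show 2 ^ n * 2 + (2 * m + 1) = 2 * (2 ^ n + m) + 1 by ring, tm_two_mul_add_one,
        tm_two_mul_add_one, ih m (by omega)]

/-- The sequence `λ₁λ₂⋯` indexed from `0`. -/
def lamSeq (i : ℕ) : ℤ := lam (i + 1)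

lemma lamSeq_eq (i : ℕ) : lamSeq i = (tm (i + 1) : ℤ) - tm i := rfl

lemma isDig_lamSeq : IsDig lamSeq := fun i => by
  have h1 := tm_le_one (i + 1)
  have h2 := tm_le_one i
  rw [lamSeq_eq]
  exact abs_le.2 (by omega)

lemma lamSeq_zero : lamSeq 0 = 1 := by
  have h0 : tm 0 = 0 := by rw [tm]
  have h1 := tm_two_mul_add_one 0
  simp only [mul_zero, zero_add] at h1
  rw [lamSeq_eq, zero_add, h1, h0]
  norm_num

lemma lamSeq_pow_add {n i : ℕ} (hi : i + 1 < 2 ^ n) : lamSeq (2 ^ n + i) = -lamSeq i := by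
  have h1 := tm_pow_add n i (by omega)
  have h2 := tm_pow_add n (i + 1) hi
  have h3 := tm_le_one i
  have h4 := tm_le_one (i + 1)
  rw [lamSeq_eq, lamSeq_eq, add_assoc, h1, h2]
  omega

lemma lamSeq_last (n : ℕ) : lamSeq (2 ^ n - 1) = 1 - tm (2 ^ n - 1) := by
  have h1 := tm_pow_add n 0 (by positivity)
  have h0 : tm 0 = 0 := by rw [tm]
  have : 0 < 2 ^ n := by positivity
  rw [lamSeq_eq, show 2 ^ n - 1 + 1 = 2 ^ n + 0 by omega, h1, h0]
  norm_num

lemma lamSeq_last_succ (n : ℕ) :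
    lamSeq (2 ^ n + (2 ^ n - 1)) = 1 - lamSeq (2 ^ n - 1) := by
  have : 0 < 2 ^ n := by positivity
  have h := lamSeq_last (n + 1)
  have h1 := tm_pow_add n (2 ^ n - 1) (by omega)
  have h2 := tm_le_one (2 ^ n - 1)
  rw [pow_succ, show 2 ^ n * 2 - 1 = 2 ^ n + (2 ^ n - 1) by omega, h1] at h
  rw [lamSeq_last, h]
  omega

/-- The unique expansion of `1` is lexicographically at least the Thue–Morse expansion. -/
lemma IsUnivoque.not_lt_lamSeq {p : ℝ} (hp : 1 < p) (hp3 : p ≤ 3) {γ : ℕ → ℤ}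
    (h : IsUnivoque p γ) (hv : val p γ = 1 - 1 / (p - 1)) {k : ℕ}
    (he : ∀ i < k, γ i = lamSeq i) : lamSeq k ≤ γ k := by
  by_contra! hk
  have hpos := one_sub_pos_of_isUnivoque hp hp3 h hv
  rcases Nat.eq_zero_or_pos k with rfl | hk0
  · rw [lamSeq_zero] at hk
    have hs := val_succ hp h.1.abs_le
    rw [hv, eq_div_iff (by linarith)] at hs
    have h1 := h.val_tail_lt hp hp3 hk
    have e : (fun i => γ (0 + 1 + i)) = fun i => γ (i + 1) := by
      funext i
      rw [zero_add, add_comm]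
    rw [e] at h1
    have h2 : (γ 0 : ℝ) ≤ 0 := by exact_mod_cast Int.lt_add_one_iff.1 hk
    nlinarith
  obtain ⟨n, hn1, hn2⟩ : ∃ n, 2 ^ n ≤ k ∧ k < 2 ^ (n + 1) :=
    ⟨Nat.log 2 k, Nat.pow_log_le_self 2 hk0.ne', Nat.lt_pow_succ_log_self (by norm_num) k⟩
  have hLpos : 0 < 2 ^ n := by positivity
  have hlast := lamSeq_last n
  have hlast' := lamSeq_last_succ n
  have hadd : ∀ i, i + 1 < 2 ^ n → lamSeq (2 ^ n + i) = -lamSeq i := fun i => lamSeq_pow_add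
  have htm := tm_le_one (2 ^ n - 1)
  rw [pow_succ] at hn2
  generalize 2 ^ n = L at *
  have hγL : γ (L - 1) = lamSeq (L - 1) := he _ (by omega)
  have hs : IsDig (fun i => -γ (L + i)) := (h.1.shift L).neg
  have hsv : val p (fun i => -γ (L + i)) < val p γ := by
    have := h.lt_val_tail hp hp3 (n := L - 1) (by omega)
    rw [show L - 1 + 1 = L by omega] at this
    rw [val_neg p (fun i => γ (L + i)), hv]
    linarith
  obtain ⟨j, hj, hjne⟩ := exists_first_diff (s := fun i => -γ (L + i)) (s' := γ) fun e => by
    rw [e] at hsv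
    exact lt_irrefl _ hsv
  have hjlt : -γ (L + j) < γ j := by
    by_contra! hc
    exact hsv.not_gt (h.val_lt_val' hp hp3 hs hj (lt_of_le_of_ne hc (Ne.symm hjne)))
  -- the first `L` digits after position `L` are forced to be the reflection of the first `L`
  have hagree : ∀ i, L + i < k → -γ (L + i) = γ i := fun i hi => by
    rw [he _ hi, hadd i (by omega), he i (by omega), neg_neg]
  have hjk : k ≤ L + j := by
    by_contra! hc
    have := hagree j hc
    omega
  obtain ⟨m, rfl⟩ : ∃ m, k = L + m := ⟨k - L, by omega⟩
  by_cases hm : m + 1 < L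
  · rw [hadd m hm] at hk
    have hγm : γ m = lamSeq m := he m (by omega)
    rcases eq_or_lt_of_le (show m ≤ j by omega) with rfl | hmj
    · omega
    · have := hj m hmj
      omega
  obtain rfl : m = L - 1 := by omega
  rw [hlast'] at hk
  rcases eq_or_lt_of_le (show L - 1 ≤ j by omega) with rfl | hmj
  · omega
  have hγ2 := hj (L - 1) hmj
  have hlt := h.val_tail_lt hp hp3 (n := L + (L - 1)) (by omega)
  rw [← hv, show L + (L - 1) + 1 = L + L by omega] at hlt
  refine hlt.not_gt (h.val_lt_val' hp hp3 (h.1.shift _) (k := j - L) (fun i hi => ?_) ?_)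
  · have h1 := hj i (by omega)
    have h2 := hj (L + i) (by omega)
    rw [← add_assoc] at h2
    omega
  · have h1 := hj (j - L) (by omega)
    rw [show L + (j - L) = j by omega] at h1
    rw [show L + L + (j - L) = L + j by omega]
    omega

lemma val_lamSeq_lt {p q : ℝ} (hp : 1 < p) (hpq : p < q) (hp3 : p ≤ 3) {γ : ℕ → ℤ}
    (h : IsUnivoque p γ) (hv : val p γ = 1 - 1 / (p - 1)) :
    val q lamSeq < 1 - 1 / (q - 1) := by
  have hq : 1 < q := hp.trans hpq
  have hle : val p lamSeq ≤ val p γ := by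
    by_cases e : lamSeq = γ
    · rw [e]
    · obtain ⟨k, hk, hne⟩ := exists_first_diff e
      have := h.not_lt_lamSeq hp hp3 hv (k := k) fun i hi => (hk i hi).symm
      exact (h.val_lt_val hp hp3 isDig_lamSeq hk (lt_of_le_of_ne this hne)).le
  have hsum : ∀ r : ℝ, 1 < r → HasSum (fun i => ((lamSeq i : ℝ) + 1) / r ^ (i + 1))
      (val r lamSeq + 1 / (r - 1)) := by
    intro r hr
    refine ((summable_val hr isDig_lamSeq.abs_le).hasSum.add (hasSum_geom_div hr 1)).congr_fun
      fun i => ?_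
    ring
  have hnn : ∀ i, 0 ≤ (lamSeq i : ℝ) + 1 := fun i => by
    have := (abs_le.1 (isDig_lamSeq.abs_le i)).1
    linarith
  have hlt : val q lamSeq + 1 / (q - 1) < val p lamSeq + 1 / (p - 1) := by
    refine hasSum_lt (i := 0) (fun i => ?_) ?_ (hsum q hq) (hsum p hp)
    · have := hnn i
      gcongr
    · rw [lamSeq_zero]
      push_cast
      gcongr
  linarith

/-- Lexicographic comparison of the first `N` letters. -/
def LexLE (N : ℕ) (s t : ℕ → ℤ) : Prop :=
  (∀ i < N, s i = t i) ∨ ∃ k < N, (∀ i < k, s i = t i) ∧ s k < t k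

/-- Sequences all of whose tails are lexicographically small have small values. -/
lemma val_tail_le {q A : ℝ} (hq : 1 < q) {N : ℕ} {t : ℕ → ℤ} (ht : IsDig t)
    (hlex : ∀ n, LexLE N (fun i => t (n + i)) lamSeq)
    (hA : val q lamSeq + 2 / (q - 1) / q ^ N ≤ A) (hA1 : A ≤ 1 - 1 / (q - 1)) (n : ℕ) :
    val q (fun i => t (n + i)) ≤ A := by
  have hq0 : 0 < q - 1 := by linarith
  have hB : 0 < 1 / (q - 1) := by positivity
  have hA0 : val q lamSeq ≤ A := by
    have : 0 ≤ 2 / (q - 1) / q ^ N := by positivity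
    linarith
  have key : ∀ m n, val q (fun i => t (n + i)) ≤ A + 2 / (q - 1) * q⁻¹ ^ m := by
    intro m
    induction m with
    | zero =>
      intro n
      have h1 := (abs_le.1 (abs_val_le hq (ht.shift n).abs_le)).2
      have h2 := (abs_le.1 (abs_val_le hq isDig_lamSeq.abs_le)).1
      have : 2 / (q - 1) = 1 / (q - 1) + 1 / (q - 1) := by ring
      rw [pow_zero, mul_one]
      linarith
    | succ m ih =>
      intro n
      rcases hlex n with h | ⟨k, hk, he, hlt⟩
      · have hd : val q (fun i => t (n + i)) - val q lamSeq ≤ 2 / (q - 1) / q ^ N := by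
          have hdig := (ht.shift n).abs_sub_le isDig_lamSeq
          rw [← val_sub hq (ht.shift n).abs_le isDig_lamSeq.abs_le,
            val_eq_tail hq hdig N fun i hi => sub_eq_zero.2 (h i hi)]
          gcongr
          exact (abs_le.1 (abs_val_le hq fun i => hdig (N + i))).2
        have : 0 ≤ 2 / (q - 1) * q⁻¹ ^ (m + 1) := by positivity
        linarith
      · have hd := val_sub_val hq (ht.shift n) isDig_lamSeq k he
        have h1 : ((t (n + k) : ℤ) : ℝ) + 1 ≤ lamSeq k := by exact_mod_cast hlt
        have h2 := (abs_le.1 (abs_val_le hq (isDig_lamSeq.shift (k + 1)).abs_le)).1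
        have h3 := ih (n + (k + 1))
        simp only [add_assoc] at h3 hd
        simp only [add_assoc] at h2
        have h4 : val q (fun i => t (n + i)) - val q lamSeq ≤
            (2 / (q - 1) * q⁻¹ ^ m) / q ^ (k + 1) := by
          rw [hd]
          gcongr
          linarith
        have h5 : (2 / (q - 1) * q⁻¹ ^ m) / q ^ (k + 1) ≤ (2 / (q - 1) * q⁻¹ ^ m) / q := by
          gcongr
          exact le_self_pow₀ hq.le (by omega)
        have h6 : (2 / (q - 1) * q⁻¹ ^ m) / q = 2 / (q - 1) * q⁻¹ ^ (m + 1) := by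
          rw [pow_succ]; ring
        linarith
  have hlim : Tendsto (fun m : ℕ => A + 2 / (q - 1) * q⁻¹ ^ m) atTop
      (nhds (A + 2 / (q - 1) * 0)) :=
    ((tendsto_pow_atTop_nhds_zero_of_lt_one (by positivity)
      (inv_lt_one_of_one_lt₀ hq)).const_mul _).const_add _
  rw [mul_zero, add_zero] at hlim
  exact ge_of_tendsto' hlim fun m => key m n

lemma isUnivoque_of_abs_val_lt {q : ℝ} (hq : 1 < q) {t : ℕ → ℤ} (ht : IsDig t)
    (h : ∀ n, |val q (fun i => t (n + i))| < 1 - 1 / (q - 1)) : IsUnivoque q t := by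
  refine ⟨ht, fun s hs he => ?_⟩
  by_contra hne
  obtain ⟨k, hk, hkne⟩ := exists_first_diff hne
  have hd := val_sub_val hq hs ht k hk
  rw [he, sub_self, eq_comm, div_eq_zero_iff, or_iff_left (by positivity)] at hd
  have h1 := abs_lt.1 (h (k + 1))
  have h2 := abs_le.1 (abs_val_le hq (hs.shift (k + 1)).abs_le)
  rcases lt_or_gt_of_ne hkne with hlt | hlt
  · have : (s k : ℝ) + 1 ≤ t k := by exact_mod_cast hlt
    linarith
  · have : (t k : ℝ) + 1 ≤ s k := by exact_mod_cast hlt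
    linarith

/-- The Thue–Morse substitution `0 ↦ 01`, `1 ↦ 10`. -/
def morse (y : ℕ → ℤ) (m : ℕ) : ℤ := if m % 2 = 0 then y (m / 2) else 1 - y (m / 2)

lemma morse_two_mul (y : ℕ → ℤ) (m : ℕ) : morse y (2 * m) = y m := by
  simp [morse]

lemma morse_two_mul_add_one (y : ℕ → ℤ) (m : ℕ) : morse y (2 * m + 1) = 1 - y m := by
  rw [morse, if_neg (by omega)]
  congr 2
  omega

/-- The Thue–Morse sequence with integer values. -/
def tmSeq (i : ℕ) : ℤ := tm i

lemma morse_tmSeq : morse tmSeq = tmSeq := by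
  funext m
  obtain ⟨m, rfl | rfl⟩ := Nat.even_or_odd' m
  · rw [morse_two_mul, tmSeq, tmSeq, tm_two_mul]
  · have := tm_le_one m
    rw [morse_two_mul_add_one, tmSeq, tmSeq, tm_two_mul_add_one]
    omega

lemma LexLE.morse {N : ℕ} {s t : ℕ → ℤ} (h : LexLE N s t) :
    LexLE (2 * N) (morse s) (morse t) := by
  have aux : ∀ k, (∀ i < k, s i = t i) → ∀ i < 2 * k, _root_.morse s i = _root_.morse t i := by
    intro k hk i hi
    obtain ⟨m, rfl | rfl⟩ := Nat.even_or_odd' i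
    · rw [morse_two_mul, morse_two_mul, hk m (by omega)]
    · rw [morse_two_mul_add_one, morse_two_mul_add_one, hk m (by omega)]
  rcases h with h | ⟨k, hk, he, hlt⟩
  · exact Or.inl (aux N h)
  · refine Or.inr ⟨2 * k, by omega, aux k he, ?_⟩
    rwa [morse_two_mul, morse_two_mul]

/-- Binary sequences all of whose tails are, up to reflection, bounded by the Thue–Morse sequence
on the first `N` letters. -/
def IsMorseBounded (N : ℕ) (x : ℕ → ℤ) : Prop :=
  (∀ i, x i = 0 ∨ x i = 1) ∧ ∀ n,
    (x n = 0 → LexLE N (fun i => x (n + i)) tmSeq) ∧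
    (x n = 1 → LexLE N (fun i => 1 - x (n + i)) tmSeq)

lemma tmSeq_zero : tmSeq 0 = 0 := by
  rw [tmSeq, tm]; rfl

lemma tmSeq_one : tmSeq 1 = 1 := by
  have := morse_two_mul_add_one tmSeq 0
  rwa [morse_tmSeq, tmSeq_zero] at this

lemma tmSeq_two : tmSeq 2 = 1 := by
  have := morse_two_mul tmSeq 1
  rwa [morse_tmSeq, tmSeq_one] at this

lemma isMorseBounded_three {x : ℕ → ℤ} (hx : ∀ i, x i = 0 ∨ x i = 1) : IsMorseBounded 3 x := by
  have key : ∀ s : ℕ → ℤ, (∀ i, s i = 0 ∨ s i = 1) → s 0 = 0 → LexLE 3 s tmSeq := by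
    intro s hs h0
    rcases hs 1 with h1 | h1
    · refine Or.inr ⟨1, by norm_num, fun i hi => ?_, by rw [h1, tmSeq_one]; norm_num⟩
      obtain rfl : i = 0 := by omega
      rw [h0, tmSeq_zero]
    · rcases hs 2 with h2 | h2
      · refine Or.inr ⟨2, by norm_num, fun i hi => ?_, by rw [h2, tmSeq_two]; norm_num⟩
        interval_cases i
        · rw [h0, tmSeq_zero]
        · rw [h1, tmSeq_one]
      · refine Or.inl fun i hi => ?_
        interval_cases i
        · rw [h0, tmSeq_zero]
        · rw [h1, tmSeq_one]
        · rw [h2, tmSeq_two]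
  refine ⟨hx, fun n => ⟨fun h => key _ (fun i => hx _) h, fun h => key _ (fun i => ?_) ?_⟩⟩
  · have := hx (n + i)
    omega
  · rw [add_zero, h, sub_self]

lemma IsMorseBounded.morse {N : ℕ} (hN : 2 ≤ N) {y : ℕ → ℤ} (hy : IsMorseBounded N y) :
    IsMorseBounded (2 * N) (morse y) := by
  have hodd : ∀ s : ℕ → ℤ, s 0 = 0 → (s 1 = 0 ∨ s 1 = 1 ∧ s 2 = 0) → LexLE (2 * N) s tmSeq := by
    intro s h0 h
    rcases h with h1 | ⟨h1, h2⟩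
    · refine Or.inr ⟨1, by omega, fun i hi => ?_, by rw [h1, tmSeq_one]; norm_num⟩
      obtain rfl : i = 0 := by omega
      rw [h0, tmSeq_zero]
    · refine Or.inr ⟨2, by omega, fun i hi => ?_, by rw [h2, tmSeq_two]; norm_num⟩
      interval_cases i
      · rw [h0, tmSeq_zero]
      · rw [h1, tmSeq_one]
  have hx : ∀ i, _root_.morse y i = 0 ∨ _root_.morse y i = 1 := by
    intro i
    obtain ⟨m, rfl | rfl⟩ := Nat.even_or_odd' i
    · rw [morse_two_mul]; exact hy.1 m
    · rw [morse_two_mul_add_one]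
      have := hy.1 m
      omega
  refine ⟨hx, fun n => ?_⟩
  obtain ⟨m, rfl | rfl⟩ := Nat.even_or_odd' n
  · have e1 : (fun i => _root_.morse y (2 * m + i)) = _root_.morse (fun i => y (m + i)) := by
      funext i
      obtain ⟨j, rfl | rfl⟩ := Nat.even_or_odd' i
      · rw [← mul_add, morse_two_mul, morse_two_mul]
      · rw [← add_assoc, ← mul_add, morse_two_mul_add_one, morse_two_mul_add_one]
    have e2 : (fun i => 1 - _root_.morse y (2 * m + i)) =
        _root_.morse (fun i => 1 - y (m + i)) := by
      funext i
      obtain ⟨j, rfl | rfl⟩ := Nat.even_or_odd' i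
      · rw [← mul_add, morse_two_mul, morse_two_mul]
      · rw [← add_assoc, ← mul_add, morse_two_mul_add_one, morse_two_mul_add_one]
    rw [morse_two_mul, e1, e2]
    constructor
    · intro h
      have := ((hy.2 m).1 h).morse
      rwa [morse_tmSeq] at this
    · intro h
      have := ((hy.2 m).2 h).morse
      rwa [morse_tmSeq] at this
  · have e1 : _root_.morse y (2 * m + 1 + 1) = y (m + 1) := morse_two_mul y (m + 1)
    have e2 : _root_.morse y (2 * m + 1 + 2) = 1 - y (m + 1) := morse_two_mul_add_one y (m + 1)
    have := hy.1 (m + 1)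
    constructor
    · intro h
      refine hodd _ h ?_
      rw [e1, e2]
      omega
    · intro h
      refine hodd _ ?_ ?_
      · rw [add_zero, h, sub_self]
      · rw [e1, e2]
        omega

/-- The difference sequence. -/
def diffSeq (x : ℕ → ℤ) (i : ℕ) : ℤ := x (i + 1) - x i

lemma isDig_diffSeq {x : ℕ → ℤ} (hx : ∀ i, x i = 0 ∨ x i = 1) : IsDig (diffSeq x) := fun i => by
  have h1 := hx i
  have h2 := hx (i + 1)
  exact abs_le.2 (by rw [diffSeq]; omega)

lemma LexLE.diffSeq {N : ℕ} {x : ℕ → ℤ} (h0 : x 0 = 0)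
    (h : LexLE (N + 1) x tmSeq) : LexLE N (diffSeq x) lamSeq := by
  rcases h with h | ⟨k, hk, he, hlt⟩
  · left
    intro i hi
    rw [_root_.diffSeq, lamSeq_eq, h i (by omega), h (i + 1) (by omega)]
    rfl
  · have hk0 : k ≠ 0 := by
      rintro rfl
      rw [tmSeq_zero, h0] at hlt
      exact lt_irrefl _ hlt
    obtain ⟨k, rfl⟩ := Nat.exists_eq_succ_of_ne_zero hk0
    refine Or.inr ⟨k, by omega, fun i hi => ?_, ?_⟩
    · rw [_root_.diffSeq, lamSeq_eq, he i (by omega), he (i + 1) (by omega)]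
      rfl
    · rw [_root_.diffSeq, lamSeq_eq, he k (by omega)]
      exact sub_lt_sub_right hlt _

lemma lexLE_diffSeq_of_bounded {N : ℕ} (hN : 0 < N) {x : ℕ → ℤ} (hx : ∀ i, x i = 0 ∨ x i = 1)
    (h : x 0 = 0 → LexLE (N + 1) x tmSeq) : LexLE N (diffSeq x) lamSeq := by
  rcases hx 0 with h0 | h0
  · exact (h h0).diffSeq h0
  · refine Or.inr ⟨0, hN, by simp, ?_⟩
    have := hx 1
    rw [diffSeq, lamSeq_zero, zero_add, h0]
    omega

lemma IsMorseBounded.isUnivoque {q : ℝ} (hq : 1 < q) {N : ℕ} (hN : 0 < N) {x : ℕ → ℤ}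
    (hx : IsMorseBounded (N + 1) x)
    (hA : val q lamSeq + 2 / (q - 1) / q ^ N < 1 - 1 / (q - 1)) :
    IsUnivoque q (diffSeq x) := by
  have h1 := val_tail_le hq (isDig_diffSeq hx.1) (fun n => lexLE_diffSeq_of_bounded hN
    (x := fun i => x (n + i)) (fun i => hx.1 _) (hx.2 n).1) le_rfl hA.le
  have h2 := val_tail_le hq (t := fun i => -diffSeq x i) (isDig_diffSeq hx.1).neg (fun n => by
    have hr : ∀ i, 1 - x i = 0 ∨ 1 - x i = 1 := fun i => by
      have := hx.1 i
      omega
    have := lexLE_diffSeq_of_bounded hN (x := fun i => 1 - x (n + i)) (fun i => hr _)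
      (fun h => (hx.2 n).2 (by rw [add_zero] at h; omega))
    convert this using 2 with i
    simp only [diffSeq, ← add_assoc]
    ring) le_rfl hA.le
  refine isUnivoque_of_abs_val_lt hq (isDig_diffSeq hx.1) fun n => abs_lt.2 ⟨?_, ?_⟩
  · have := h2 n
    rw [val_neg q fun i => diffSeq x (n + i)] at this
    linarith
  · exact (h1 n).trans_lt hA

/-- The sequence has zeros of density `d`, with bounded discrepancy. -/
def HasZeroDensity (z : ℕ → ℤ) (d : ℝ) : Prop :=
  ∃ K : ℝ, ∀ n : ℕ, |(Nat.count (fun i => z i = 0) n : ℝ) - d * n| ≤ K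

lemma exists_binary_density {d : ℝ} (hd : 0 ≤ d) (hd1 : d ≤ 1) :
    ∃ y : ℕ → ℤ, (∀ i, y i = 0 ∨ y i = 1) ∧ HasZeroDensity (diffSeq y) d := by
  let F : ℕ → ℕ := fun n => ⌊(n : ℝ) * d⌋₊
  have hF : ∀ n, F (n + 1) = F n ∨ F (n + 1) = F n + 1 := by
    intro n
    have h1 : F n ≤ F (n + 1) := Nat.floor_le_floor (by push_cast; nlinarith)
    have h2 : F (n + 1) ≤ F n + 1 := by
      rw [← Nat.floor_add_one (by positivity)]
      exact Nat.floor_le_floor (by push_cast; nlinarith)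
    omega
  let y : ℕ → ℤ := fun n => Nat.rec 0 (fun n a => if F (n + 1) = F n then 1 - a else a) n
  have hy : ∀ n, y (n + 1) = if F (n + 1) = F n then 1 - y n else y n := fun n => rfl
  have hyb : ∀ i, y i = 0 ∨ y i = 1 := by
    intro i
    induction i with
    | zero => exact Or.inl rfl
    | succ n ih =>
      rw [hy]
      split_ifs <;> omega
  refine ⟨y, hyb, 1, fun n => ?_⟩
  have hc : Nat.count (fun i => diffSeq y i = 0) n = F n := by
    induction n with
    | zero => simp [F]
    | succ n ih =>
      rw [Nat.count_succ, ih]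
      have h1 := hyb n
      have h2 := hF n
      simp only [diffSeq, hy]
      split_ifs <;> omega
  have h1 := Nat.floor_le (show 0 ≤ (n : ℝ) * d by positivity)
  have h2 := Nat.lt_floor_add_one ((n : ℝ) * d)
  rw [hc, abs_le]
  constructor <;> simp only [F] <;> linarith

lemma count_diffSeq_morse {y : ℕ → ℤ} (hy : ∀ i, y i = 0 ∨ y i = 1) (n : ℕ) :
    Nat.count (fun i => diffSeq (morse y) i = 0) (2 * n) +
      Nat.count (fun i => diffSeq y i = 0) n = n := by
  induction n with
  | zero => simp
  | succ n ih =>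
    rw [show 2 * (n + 1) = 2 * n + 1 + 1 by ring, Nat.count_succ, Nat.count_succ, Nat.count_succ]
    have h0 := hy n
    have h1 := hy (n + 1)
    have e1 : morse y (2 * n + 1 + 1) = y (n + 1) := morse_two_mul y (n + 1)
    have h2 : ¬ diffSeq (morse y) (2 * n) = 0 := by
      rw [diffSeq, morse_two_mul_add_one, morse_two_mul]
      omega
    have h3 : diffSeq (morse y) (2 * n + 1) = 0 ↔ ¬ diffSeq y n = 0 := by
      rw [diffSeq, diffSeq, e1, morse_two_mul_add_one]
      omega
    rw [if_neg h2]
    by_cases h : diffSeq y n = 0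
    · rw [if_neg (by simpa [h3] using h), if_pos h]
      omega
    · rw [if_pos (h3.2 h), if_neg h]
      omega

lemma HasZeroDensity.morse {y : ℕ → ℤ} (hy : ∀ i, y i = 0 ∨ y i = 1) {d : ℝ}
    (h : HasZeroDensity (diffSeq y) (1 - 2 * d)) (hd : |d| ≤ 1) :
    HasZeroDensity (diffSeq (morse y)) d := by
  obtain ⟨K, hK⟩ := h
  have hev : ∀ n : ℕ, |(Nat.count (fun i => diffSeq (_root_.morse y) i = 0) (2 * n) : ℝ)
      - d * (2 * n)| ≤ K := by
    intro n
    have h1 : (Nat.count (fun i => diffSeq (_root_.morse y) i = 0) (2 * n) : ℝ) +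
      Nat.count (fun i => diffSeq y i = 0) n = n := by exact_mod_cast count_diffSeq_morse hy n
    have h2 := abs_le.1 (hK n)
    exact abs_le.2 ⟨by linarith, by linarith⟩
  refine ⟨K + 2, fun n => ?_⟩
  have hd' := abs_le.1 hd
  obtain ⟨m, rfl | rfl⟩ := Nat.even_or_odd' n
  · have := hev m
    push_cast
    linarith
  · have := abs_le.1 (hev m)
    rw [Nat.count_succ, abs_le]
    push_cast
    constructor <;> split_ifs <;> linarith

lemma exists_isMorseBounded (k : ℕ) {d : ℝ} (hd : |d - 1 / 3| ≤ 1 / 3 * (1 / 2) ^ k) :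
    ∃ x, IsMorseBounded (3 * 2 ^ k) x ∧ HasZeroDensity (diffSeq x) d := by
  induction k generalizing d with
  | zero =>
    rw [pow_zero, mul_one] at hd
    have := abs_le.1 hd
    obtain ⟨y, hy, hyd⟩ := exists_binary_density (d := d) (by linarith) (by linarith)
    exact ⟨y, isMorseBounded_three hy, hyd⟩
  | succ k ih =>
    have h1 : (1 / 2 : ℝ) ^ k ≤ 1 := pow_le_one₀ (by norm_num) (by norm_num)
    rw [pow_succ] at hd
    obtain ⟨h2, h3⟩ := abs_le.1 hd
    obtain ⟨y, hy, hyd⟩ := ih (d := 1 - 2 * d) (abs_le.2 ⟨by linarith, by linarith⟩)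
    refine ⟨morse y, ?_, hyd.morse hy.1 (abs_le.2 ⟨by linarith, by linarith⟩)⟩
    have : 0 < 2 ^ k := by positivity
    rw [show 3 * 2 ^ (k + 1) = 2 * (3 * 2 ^ k) by ring]
    exact hy.morse (by omega)

lemma abs_val_sub_val_le {q M : ℝ} (hq : 1 < q) {s s' : ℕ → ℤ} (hs : IsDig s) (hs' : IsDig s')
    (hM : ∀ i, |((s i - s' i : ℤ) : ℝ)| ≤ M) {n : ℕ} (h0 : ∀ i < n, s i = s' i) :
    |val q s - val q s'| ≤ M / (q - 1) / q ^ n := by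
  rw [← val_sub hq hs.abs_le hs'.abs_le, val_eq_tail hq hM n fun i hi => sub_eq_zero.2 (h0 i hi),
    abs_div, abs_of_pos (show (0 : ℝ) < q ^ n by positivity)]
  gcongr
  exact abs_val_le hq fun i => hM (n + i)

lemma le_abs_val_sub_val {q M : ℝ} (hq : 1 < q) {s s' : ℕ → ℤ} (hs : IsDig s) (hs' : IsDig s')
    (hM : ∀ i, |((s i - s' i : ℤ) : ℝ)| ≤ M) {n : ℕ} (h0 : ∀ i < n, s i = s' i)
    (hn : s n ≠ s' n) :
    (1 - M / (q - 1)) / q / q ^ n ≤ |val q s - val q s'| := by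
  rw [val_sub_val hq hs hs' n h0, abs_div, abs_of_pos (show (0 : ℝ) < q ^ (n + 1) by positivity),
    pow_succ', div_div]
  gcongr
  have h1 := val_sub hq (hs.shift (n + 1)).abs_le (hs'.shift (n + 1)).abs_le
  have h2 := abs_val_le hq fun i => hM (n + 1 + i)
  rw [h1] at h2
  have h3 : (1 : ℝ) ≤ |(s n : ℝ) - s' n| := by
    exact_mod_cast Int.one_le_abs (sub_ne_zero.2 hn)
  have h4 := abs_sub_abs_le_abs_add ((s n : ℝ) - s' n)
    (val q (fun i => s (n + 1 + i)) - val q fun i => s' (n + 1 + i))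
  rw [← add_sub_assoc] at h4
  linarith

/-- If distances between points `f a` are controlled by powers of distances between points `g a`,
then the Hausdorff dimensions of the images are related as for Hölder maps. -/
lemma dimH_image_le_of_dist_le {ι X Y : Type*} [MetricSpace X] [MetricSpace Y] (f : ι → X)
    (g : ι → Y) (S : Set ι) {C r : ℝ} (hC : 0 ≤ C) (hr : 0 < r)
    (h : ∀ a ∈ S, ∀ b ∈ S, dist (f a) (f b) ≤ C * dist (g a) (g b) ^ r) :
    dimH (f '' S) ≤ dimH (g '' S) / ENNReal.ofReal r := by
  rcases S.eq_empty_or_nonempty with rfl | ⟨a0, -⟩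
  · simp
  have : Nonempty ι := ⟨a0⟩
  have hinv : ∀ a ∈ S, Function.invFunOn g S (g a) ∈ S ∧ g (Function.invFunOn g S (g a)) = g a :=
    fun a ha => ⟨Function.invFunOn_mem ⟨a, ha, rfl⟩, Function.invFunOn_eq ⟨a, ha, rfl⟩⟩
  have himg : f '' S ⊆ (f ∘ Function.invFunOn g S) '' (g '' S) := by
    rintro _ ⟨a, ha, rfl⟩
    refine ⟨g a, ⟨a, ha, rfl⟩, ?_⟩
    have := h _ (hinv a ha).1 a ha
    rw [(hinv a ha).2, dist_self, Real.zero_rpow hr.ne', mul_zero] at this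
    exact dist_le_zero.1 this
  have hH : HolderOnWith C.toNNReal r.toNNReal (f ∘ Function.invFunOn g S) (g '' S) := by
    rintro _ ⟨a, ha, rfl⟩ _ ⟨b, hb, rfl⟩
    have h1 := h _ (hinv a ha).1 _ (hinv b hb).1
    rw [(hinv a ha).2, (hinv b hb).2] at h1
    rw [edist_dist, edist_dist, Real.coe_toNNReal r hr.le,
      ENNReal.ofReal_rpow_of_nonneg dist_nonneg hr.le, ← ENNReal.ofReal.eq_1,
      ← ENNReal.ofReal_mul hC]
    exact ENNReal.ofReal_le_ofReal h1
  exact (dimH_mono himg).trans (hH.dimH_image_le (Real.toNNReal_pos.2 hr))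

lemma HasZeroDensity.infinite {z : ℕ → ℤ} {d : ℝ} (h : HasZeroDensity z d) (hd : 0 < d) :
    (Set.ofPred fun i => z i = 0).Infinite := by
  intro hf
  obtain ⟨K, hK⟩ := h
  have hc : ∀ n, Nat.count (fun i => z i = 0) n ≤ hf.toFinset.card := fun n => by
    rw [Nat.count_eq_card_filter_range]
    refine Finset.card_le_card fun i hi => ?_
    rw [Set.Finite.mem_toFinset]
    exact (Finset.mem_filter.1 hi).2
  obtain ⟨n, hn⟩ := exists_nat_gt ((hf.toFinset.card + K) / d)
  rw [div_lt_iff₀ hd] at hn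
  have h1 := (abs_le.1 (hK n)).1
  have h2 : (Nat.count (fun i => z i = 0) n : ℝ) ≤ hf.toFinset.card := by exact_mod_cast hc n
  linarith

/-- Replace the zeros of `z` by the successive letters of `D`. -/
def fillZeros (z D : ℕ → ℤ) (i : ℕ) : ℤ :=
  if z i = 0 then D (Nat.count (fun i => z i = 0) i) else z i

/-- Positions of the letter `a`. -/
def letterInd (a : ℤ) (w : ℕ → ℤ) (i : ℕ) : ℤ := if w i = a then 1 else 0

/-- The point of the gasket in base `q` with digits `(1,0)`, `(0,1)`, `(0,0)` at the positions of
the letters `1`, `-1`, `0` of `w`. -/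
def gasketPoint (q : ℝ) (w : ℕ → ℤ) : ℝ × ℝ := (val q (letterInd 1 w), val q (letterInd (-1) w))

lemma isDig_letterInd (a : ℤ) (w : ℕ → ℤ) : IsDig (letterInd a w) := fun i => by
  rw [letterInd]
  split_ifs <;> simp

lemma abs_letterInd_sub_le (a : ℤ) (w w' : ℕ → ℤ) (i : ℕ) :
    |((letterInd a w i - letterInd a w' i : ℤ) : ℝ)| ≤ 1 := by
  rw [letterInd, letterInd]
  split_ifs <;> simp

lemma dist_gasketPoint_le {q : ℝ} (hq : 1 < q) {w w' : ℕ → ℤ} {n : ℕ}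
    (h0 : ∀ i < n, w i = w' i) :
    dist (gasketPoint q w) (gasketPoint q w') ≤ 1 / (q - 1) / q ^ n := by
  rw [Prod.dist_eq, max_le_iff]
  constructor
  all_goals
    exact abs_val_sub_val_le hq (isDig_letterInd _ w) (isDig_letterInd _ w')
      (abs_letterInd_sub_le _ w w') fun i hi => by rw [letterInd, letterInd, h0 i hi]

lemma le_dist_gasketPoint {q : ℝ} (hq : 1 < q) {w w' : ℕ → ℤ} (hw : IsDig w) (hw' : IsDig w')
    {n : ℕ} (h0 : ∀ i < n, w i = w' i) (hn : w n ≠ w' n) :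
    (1 - 1 / (q - 1)) / q / q ^ n ≤ dist (gasketPoint q w) (gasketPoint q w') := by
  have key : ∀ a, letterInd a w n ≠ letterInd a w' n → (1 - 1 / (q - 1)) / q / q ^ n ≤
      |val q (letterInd a w) - val q (letterInd a w')| := fun a ha =>
    le_abs_val_sub_val hq (isDig_letterInd _ w) (isDig_letterInd _ w')
      (abs_letterInd_sub_le _ w w') (fun i hi => by rw [letterInd, letterInd, h0 i hi]) ha
  have h1 := abs_le.1 (hw n)
  have h2 := abs_le.1 (hw' n)
  rw [Prod.dist_eq, le_max_iff]
  by_cases h : letterInd 1 w n = letterInd 1 w' n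
  · refine Or.inr (key (-1) ?_)
    simp only [letterInd] at h ⊢
    split_ifs at h ⊢ <;> omega
  · exact Or.inl (key 1 h)

lemma isDig_fillZeros {z D : ℕ → ℤ} (hz : IsDig z) (hD : IsDig D) : IsDig (fillZeros z D) :=
  fun i => by
    rw [fillZeros]
    split_ifs
    exacts [hD _, hz i]

/-- If `D` and `D'` first differ at `J`, the filled sequences first differ at the position of the
`J`-th zero. -/
lemma fillZeros_first_diff {z D D' : ℕ → ℤ} (hz : (Set.ofPred fun i => z i = 0).Infinite)
    {J : ℕ} (h : ∀ i < J, D i = D' i) (hJ : D J ≠ D' J) :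
    ∃ n, Nat.count (fun i => z i = 0) n = J ∧ (∀ i < n, fillZeros z D i = fillZeros z D' i) ∧
      fillZeros z D n ≠ fillZeros z D' n := by
  have hc := Nat.count_nth_of_infinite hz J
  have hm : z (Nat.nth (fun i => z i = 0) J) = 0 := Nat.nth_mem_of_infinite hz J
  refine ⟨Nat.nth (fun i => z i = 0) J, hc, fun i hi => ?_, ?_⟩
  · rw [fillZeros, fillZeros]
    split_ifs with h0
    · refine h _ ?_
      rw [← hc]
      exact Nat.count_strict_mono (p := fun i => z i = 0) h0 hi
    · rfl
  · rw [fillZeros, fillZeros, if_pos hm, if_pos hm, hc]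
    exact hJ

lemma rpow_pow_eq {q b d s : ℝ} (hq : 0 < q) (hb : 0 < b) (hs : q ^ s = b ^ d) (n : ℕ) :
    (q ^ n) ^ s = b ^ (d * n) := by
  rw [← Real.rpow_natCast, ← Real.rpow_mul hq.le, mul_comm, Real.rpow_mul hq.le, hs,
    ← Real.rpow_mul hb.le]

lemma rpow_log_div_log {q b d : ℝ} (hq : 1 < q) (hb : 0 < b) :
    q ^ (d * (Real.log b / Real.log q)) = b ^ d := by
  have := Real.log_pos hq
  rw [Real.rpow_def_of_pos (by linarith), Real.rpow_def_of_pos hb]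
  congr 1
  field_simp

lemma le_dimH_fill {q d : ℝ} (hq : 2 < q) (hd : 0 < d) {z : ℕ → ℤ} (hz : IsDig z)
    (hzd : HasZeroDensity z d) :
    ENNReal.ofReal (d * (Real.log 3 / Real.log q)) ≤
      dimH ((fun D => gasketPoint q (fillZeros z D)) '' {D | IsDig D}) := by
  have hq1 : 1 < q := by linarith
  have hinf := hzd.infinite hd
  obtain ⟨K, hK⟩ := hzd
  set s := d * (Real.log 3 / Real.log q) with hs
  have hs0 : 0 < s := by
    have := Real.log_pos hq1
    have := Real.log_pos (show (1 : ℝ) < 3 by norm_num)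
    positivity
  set c := (1 - 1 / (q - 1)) / q with hc
  have hc0 : 0 < c := by
    have : 1 / (q - 1) < 1 := by rw [div_lt_one] <;> linarith
    have : 0 < 1 - 1 / (q - 1) := by linarith
    positivity
  have h := dimH_image_le_of_dist_le (val 3) (fun D => gasketPoint q (fillZeros z D)) {D | IsDig D}
    (C := 3 ^ K * (c⁻¹) ^ s) (r := s) (by positivity) hs0 (fun D hD D' hD' => by
      by_cases hne : D = D'
      · rw [hne, dist_self]
        positivity
      obtain ⟨J, hJ, hJne⟩ := exists_first_diff hne
      obtain ⟨n, hn, h0, hn0⟩ := fillZeros_first_diff hinf hJ hJne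
      have h1 := le_dist_gasketPoint hq1 (isDig_fillZeros hz hD) (isDig_fillZeros hz hD') h0 hn0
      have h2 := abs_val_sub_val_le (q := 3) (by norm_num) hD hD' (IsDig.abs_sub_le hD hD') hJ
      have h3 := (abs_le.1 (hK n)).1
      rw [hn] at h3
      have h4 : (1 : ℝ) / 3 ^ J ≤ 3 ^ K * ((q ^ n) ^ s)⁻¹ := by
        rw [rpow_pow_eq (by linarith) (by norm_num) (rpow_log_div_log hq1 (by norm_num)),
          ← Real.rpow_neg (by norm_num), ← Real.rpow_add (by norm_num), one_div,
          ← Real.rpow_natCast, ← Real.rpow_neg (by norm_num)]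
        exact Real.rpow_le_rpow_of_exponent_le (by norm_num) (by linarith)
      have h5 : ((q ^ n) ^ s)⁻¹ ≤ c⁻¹ ^ s * dist (gasketPoint q (fillZeros z D))
          (gasketPoint q (fillZeros z D')) ^ s := by
        rw [← Real.mul_rpow (by positivity) dist_nonneg, ← Real.inv_rpow (by positivity)]
        refine Real.rpow_le_rpow (by positivity) ?_ hs0.le
        rw [div_eq_mul_inv, ← div_le_iff₀' (by positivity)] at *
        rwa [div_eq_mul_inv, inv_inv, mul_comm]
      have h6 : dist (val 3 D) (val 3 D') ≤ 1 / 3 ^ J := by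
        refine h2.trans_eq ?_
        norm_num
      calc _ ≤ _ := h6
        _ ≤ _ := h4
        _ ≤ 3 ^ K * (c⁻¹ ^ s * dist (gasketPoint q (fillZeros z D))
          (gasketPoint q (fillZeros z D')) ^ s) := by gcongr
        _ = _ := by rw [mul_assoc])
  have himg : val 3 '' {D | IsDig D} = Set.Icc (-(1 / 2)) (1 / 2) := by
    ext x
    constructor
    · rintro ⟨D, hD, rfl⟩
      have := abs_val_le (q := 3) (by norm_num) (IsDig.abs_le hD)
      norm_num at this
      exact abs_le.1 (by norm_num; exact this)
    · intro hx
      obtain ⟨D, hD, hDx⟩ := exists_val_eq (p := 3) (by norm_num) le_rfl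
        (x := x) (by have := abs_le.2 hx; norm_num at this ⊢; exact this)
      exact ⟨D, hD, hDx⟩
  have hdim : dimH (Set.Icc (-(1 / 2) : ℝ) (1 / 2)) = 1 := by
    rw [Real.dimH_of_nonempty_interior (by rw [interior_Icc]; exact ⟨0, by norm_num⟩)]
    simp
  rw [himg, hdim, ENNReal.le_div_iff_mul_le (Or.inl (by simpa using hs0)) (Or.inl (by simp)),
    one_mul] at h
  exact h

lemma dimH_fill_le_of_base {q d b : ℝ} (hq : 2 < q) (hd : 0 < d) (hb : 3 < b) {z : ℕ → ℤ}
    (hzd : HasZeroDensity z d) :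
    dimH ((fun D => gasketPoint q (fillZeros z D)) '' {D | IsDig D}) ≤
      ENNReal.ofReal (d * (Real.log b / Real.log q)) := by
  have hq1 : 1 < q := by linarith
  have hb1 : 1 < b := by linarith
  have hinf := hzd.infinite hd
  obtain ⟨K, hK⟩ := hzd
  set s := d * (Real.log b / Real.log q) with hs
  have hs0 : 0 < s := by
    have := Real.log_pos hq1
    have := Real.log_pos hb1
    positivity
  set c := (1 - 2 / (b - 1)) / b with hc
  have hc0 : 0 < c := by
    have : 2 / (b - 1) < 1 := by rw [div_lt_one] <;> linarith
    have : 0 < 1 - 2 / (b - 1) := by linarith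
    positivity
  have hq0 : 0 < q - 1 := by linarith
  have h := dimH_image_le_of_dist_le (fun D => gasketPoint q (fillZeros z D)) (val b) {D | IsDig D}
    (C := 1 / (q - 1) * (b ^ K * c⁻¹) ^ s⁻¹) (r := s⁻¹) (by positivity) (by positivity)
    (fun D hD D' hD' => by
      by_cases hne : D = D'
      · rw [hne, dist_self]
        positivity
      obtain ⟨J, hJ, hJne⟩ := exists_first_diff hne
      obtain ⟨n, hn, h0, hn0⟩ := fillZeros_first_diff hinf hJ hJne
      have h1 := dist_gasketPoint_le hq1 h0
      have h2 : _ ≤ dist (val b D) (val b D') :=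
        le_abs_val_sub_val hb1 hD hD' (IsDig.abs_sub_le hD hD') hJ hJne
      have h3 := (abs_le.1 (hK n)).2
      rw [hn] at h3
      have h4 : ((q ^ n) ^ s)⁻¹ ≤ b ^ K * (1 / b ^ J) := by
        rw [rpow_pow_eq (by linarith) (by linarith) (rpow_log_div_log hq1 (by linarith)),
          ← Real.rpow_neg (by linarith), one_div,
          ← Real.rpow_natCast b J, ← Real.rpow_neg (by linarith), ← Real.rpow_add (by linarith)]
        exact Real.rpow_le_rpow_of_exponent_le hb1.le (by linarith)
      have h5 : 1 / b ^ J ≤ c⁻¹ * dist (val b D) (val b D') := by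
        rw [← div_le_iff₀' (by positivity), div_eq_mul_inv _ c⁻¹, inv_inv, mul_comm,
          mul_one_div]
        exact h2
      have h6 : 1 / q ^ n ≤ (b ^ K * c⁻¹) ^ s⁻¹ * dist (val b D) (val b D') ^ s⁻¹ := by
        rw [← Real.mul_rpow (by positivity) dist_nonneg,
          Real.le_rpow_inv_iff_of_pos (by positivity) (by positivity) hs0, one_div,
          Real.inv_rpow (by positivity), mul_assoc]
        exact h4.trans (by gcongr)
      calc _ ≤ _ := h1
        _ = 1 / (q - 1) * (1 / q ^ n) := by ring
        _ ≤ 1 / (q - 1) * ((b ^ K * c⁻¹) ^ s⁻¹ * dist (val b D) (val b D') ^ s⁻¹) := by gcongr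
        _ = _ := by rw [mul_assoc])
  refine h.trans ?_
  rw [ENNReal.ofReal_inv_of_pos hs0, div_eq_mul_inv, inv_inv]
  refine mul_le_of_le_one_left (by positivity) ?_
  rw [← Real.dimH_univ]
  exact dimH_mono (Set.subset_univ _)

lemma dimH_fill {q d : ℝ} (hq : 2 < q) (hd : 0 < d) {z : ℕ → ℤ} (hz : IsDig z)
    (hzd : HasZeroDensity z d) :
    dimH ((fun D => gasketPoint q (fillZeros z D)) '' {D | IsDig D}) =
      ENNReal.ofReal (d * (Real.log 3 / Real.log q)) := by
  refine le_antisymm ?_ (le_dimH_fill hq hd hz hzd)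
  have hlim : Tendsto (fun b : ℝ => ENNReal.ofReal (d * (Real.log b / Real.log q)))
      (nhdsWithin 3 (Set.Ioi 3)) (nhds (ENNReal.ofReal (d * (Real.log 3 / Real.log q)))) := by
    refine (ENNReal.continuous_ofReal.tendsto _).comp (Tendsto.mono_left ?_ nhdsWithin_le_nhds)
    exact ((Real.continuousAt_log (by norm_num)).tendsto.div_const _).const_mul _
  refine ge_of_tendsto hlim ?_
  filter_upwards [self_mem_nhdsWithin] with b hb
  exact dimH_fill_le_of_base hq hd hb hzd

lemma tsum_eq_gasketPoint {q : ℝ} (hq : 1 < q) (w : ℕ → ℤ) :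
    ∑' i, (q ^ (i + 1))⁻¹ • ((letterInd 1 w i : ℝ), (letterInd (-1) w i : ℝ)) =
      gasketPoint q w := by
  have h := (summable_val hq (isDig_letterInd 1 w).abs_le).hasSum.prodMk
    (summable_val hq (isDig_letterInd (-1) w).abs_le).hasSum
  refine Eq.trans (tsum_congr fun i => ?_) h.tsum_eq
  simp [div_eq_inv_mul]

lemma gasket_eq {q : ℝ} (hq : 1 < q) : gasket q = gasketPoint q '' {w | IsDig w} := by
  ext x
  constructor
  · rintro ⟨c, hc, rfl⟩
    have hw : ∀ i, ∃ a : ℤ, |a| ≤ 1 ∧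
        c i = (((if a = 1 then 1 else 0 : ℤ) : ℝ), ((if a = -1 then 1 else 0 : ℤ) : ℝ)) := fun i => by
      rcases hc i with h | h | h
      · exact ⟨0, by simp, by simp [h]⟩
      · exact ⟨-1, by simp, by simp [h]⟩
      · exact ⟨1, by simp, by simp [show c i = (1, 0) from h]⟩
    choose w hw1 hw2 using hw
    refine ⟨w, hw1, ?_⟩
    rw [← tsum_eq_gasketPoint hq]
    exact tsum_congr fun i => by rw [hw2 i]; rfl
  · rintro ⟨w, hw, rfl⟩
    refine ⟨_, fun i => ?_, (tsum_eq_gasketPoint hq w).symm⟩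
    have := abs_le.1 (hw i)
    have h3 : w i = -1 ∨ w i = 0 ∨ w i = 1 := by omega
    rcases h3 with h | h | h <;> simp [letterInd, Omega1, h]

lemma IsUnivoque.val_mem_uniqSet {q : ℝ} (hq : 1 < q) {z : ℕ → ℤ} (hz : IsUnivoque q z) :
    val q z ∈ uniqSet q := by
  refine ⟨abs_le.1 (abs_val_le hq hz.1.abs_le), fun i => (z i : ℝ), ⟨fun i => ?_, rfl⟩, ?_⟩
  · have := abs_le.1 (hz.1 i)
    have h3 : z i = -1 ∨ z i = 0 ∨ z i = 1 := by omega
    rcases h3 with h | h | h <;> simp [h]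
  · rintro s ⟨hs, hv⟩
    have hw : ∀ i, ∃ a : ℤ, |a| ≤ 1 ∧ s i = a := fun i => by
      rcases hs i with h | h | h
      · exact ⟨-1, by simp, by simp [h]⟩
      · exact ⟨0, by simp, by simp [h]⟩
      · exact ⟨1, by simp, by simpa using h⟩
    choose w hw1 hw2 using hw
    have : w = z := hz.2 w hw1 (by rw [hv]; exact tsum_congr fun i => by rw [hw2 i])
    funext i
    rw [hw2 i, this]

lemma letterInd_sub_letterInd {w : ℕ → ℤ} (hw : IsDig w) (i : ℕ) :
    letterInd 1 w i - letterInd (-1) w i = w i := by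
  have := abs_le.1 (hw i)
  have h3 : w i = -1 ∨ w i = 0 ∨ w i = 1 := by omega
  rcases h3 with h | h | h <;> simp [letterInd, h]

lemma letterInd_neg (a : ℤ) (w : ℕ → ℤ) : letterInd a (fun i => -w i) = letterInd (-a) w := by
  funext i
  simp only [letterInd, neg_eq_iff_eq_neg]

lemma mem_Tset {q : ℝ} (hq : 1 < q) {z : ℕ → ℤ} (hz : IsUnivoque q z) :
    (val q z, -val q z) ∈ Tset q := by
  refine ⟨?_, hz.val_mem_uniqSet hq, ?_⟩
  · rw [gasket_eq hq, Set.mem_sub]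
    refine ⟨_, ⟨z, hz.1, rfl⟩, _, ⟨_, hz.1.neg, rfl⟩, ?_⟩
    have h := val_sub hq (isDig_letterInd 1 z).abs_le (isDig_letterInd (-1) z).abs_le
    simp only [letterInd_sub_letterInd hz.1] at h
    simp only [gasketPoint, letterInd_neg, neg_neg, Prod.mk_sub_mk, Prod.mk.injEq]
    change val q z = _ at h
    constructor <;> linarith
  · have := hz.neg.val_mem_uniqSet hq
    rwa [val_neg] at this

lemma exists_eq_fillZeros {z w : ℕ → ℤ} (hw : IsDig w) (h : ∀ i, z i ≠ 0 → w i = z i) :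
    ∃ D, IsDig D ∧ w = fillZeros z D := by
  refine ⟨fun j => w (Nat.nth (fun i => z i = 0) j), fun j => hw _, ?_⟩
  funext i
  by_cases hi : z i = 0
  · rw [fillZeros, if_pos hi, Nat.nth_count (p := fun i => z i = 0) hi]
  · rw [fillZeros, if_neg hi, h i hi]

lemma gasket_inter_image_add {q : ℝ} (hq : 1 < q) {z : ℕ → ℤ} (hz : IsUnivoque q z) :
    gasket q ∩ ((· + (val q z, -val q z)) '' gasket q) =
      (fun D => gasketPoint q (fillZeros z D)) '' {D | IsDig D} := by
  rw [gasket_eq hq]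
  have key : ∀ (w w' : ℕ → ℤ) (a : ℤ), val q (fun i => letterInd a w i - letterInd a w' i) =
      val q (letterInd a w) - val q (letterInd a w') := fun w w' a =>
    val_sub hq (isDig_letterInd a w).abs_le (isDig_letterInd a w').abs_le
  have bd : ∀ (w w' : ℕ → ℤ) (a : ℤ), IsDig (fun i => letterInd a w i - letterInd a w' i) :=
    fun w w' a i => by
      simp only [letterInd]
      split_ifs <;> simp
  ext x
  constructor
  · rintro ⟨⟨w, hw, rfl⟩, ⟨_, ⟨w', hw', rfl⟩, he⟩⟩
    simp only [gasketPoint, Prod.mk_add_mk, Prod.mk.injEq] at he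
    have e1 := hz.2 _ (bd w w' 1) (by rw [key]; linarith)
    have e2 := hz.2 _ (bd w' w (-1)) (by rw [key]; linarith)
    obtain ⟨D, hD, hwD⟩ := exists_eq_fillZeros (z := z) hw fun i hi => by
      have h1 := congrFun e1 i
      have h2 := congrFun e2 i
      simp only [letterInd] at h1 h2
      split_ifs at h1 h2 <;> omega
    exact ⟨D, hD, by simp only [hwD]⟩
  · rintro ⟨D, hD, rfl⟩
    have hf := isDig_fillZeros hz.1 hD
    refine ⟨⟨_, hf, rfl⟩, ⟨_, ⟨fun i => if z i = 0 then fillZeros z D i else -z i, fun i => ?_, rfl⟩, ?_⟩⟩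
    · by_cases hi : z i = 0
      · simpa [hi] using hf i
      · simpa [hi] using hz.1 i
    · set w := fillZeros z D with hwdef
      set w' : ℕ → ℤ := fun i => if z i = 0 then w i else -z i with hw'
      have h : ∀ i, letterInd 1 w i - letterInd 1 w' i = z i ∧
          letterInd (-1) w' i - letterInd (-1) w i = z i := fun i => by
        by_cases hi : z i = 0
        · simp [letterInd, hw', hi]
        · have hwi : w i = z i := by rw [hwdef, fillZeros, if_neg hi]
          have := abs_le.1 (hz.1 i)
          have h3 : z i = -1 ∨ z i = 1 := by omega
          rcases h3 with h | h <;> simp [letterInd, hw', hwi, h]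
      have e1 := key w w' 1
      have e2 := key w' w (-1)
      rw [show (fun i => letterInd 1 w i - letterInd 1 w' i) = z from funext fun i => (h i).1] at e1
      rw [show (fun i => letterInd (-1) w' i - letterInd (-1) w i) = z from
        funext fun i => (h i).2] at e2
      simp only [gasketPoint, Prod.mk_add_mk, Prod.mk.injEq]
      constructor <;> linarith

lemma ofReal_mem_Dset {q d : ℝ} (hq : 2 < q) (hd : 0 < d) {z : ℕ → ℤ} (hz : IsUnivoque q z)
    (hzd : HasZeroDensity z d) : ENNReal.ofReal (d * (Real.log 3 / Real.log q)) ∈ Dset q := by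
  have hq1 : 1 < q := by linarith
  exact ⟨_, mem_Tset hq1 hz, by rw [gasket_inter_image_add hq1 hz, dimH_fill hq hd hz.1 hzd]⟩

lemma exists_two_div_pow_lt {q δ : ℝ} (hq : 1 < q) (hδ : 0 < δ) :
    ∃ k : ℕ, 2 / (q - 1) / q ^ (3 * 2 ^ k - 1) < δ := by
  have hq0 : 0 < q - 1 := by linarith
  obtain ⟨k, hk⟩ := pow_unbounded_of_one_lt (2 / (q - 1) / δ) hq
  refine ⟨k, ?_⟩
  rw [div_lt_iff₀ (by positivity), ← div_lt_iff₀' hδ]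
  refine hk.trans_le (pow_le_pow_right₀ hq.le ?_)
  have := Nat.lt_two_pow_self (n := k)
  omega

theorem stmt2 (qKL q : ℝ) (h1 : 1 < qKL) (h2 : uniqueOneExp qKL)
    (h3 : ∀ p, 1 < p → uniqueOneExp p → qKL ≤ p) (hq : q ∈ Set.Ioo qKL 3) :
    ∃ a b : ℝ≥0∞, a < b ∧ Set.Icc a b ⊆ Dset q := by
  obtain ⟨hq1, hq3⟩ := hq
  have hp3 : qKL ≤ 3 := by linarith
  obtain ⟨γ, hγ, hv⟩ := exists_isUnivoque h1 h2
  have hp2 : 2 < qKL := by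
    have h := one_sub_pos_of_isUnivoque h1 hp3 hγ hv
    have h' : 0 < qKL - 1 := by linarith
    rw [sub_pos, div_lt_one h'] at h
    linarith
  have hgap := val_lamSeq_lt h1 hq1 hp3 hγ hv
  have hq2 : 2 < q := hp2.trans hq1
  obtain ⟨k, hk⟩ := exists_two_div_pow_lt (q := q) (by linarith) (sub_pos.2 hgap)
  have hN : 3 * 2 ^ k - 1 + 1 = 3 * 2 ^ k ∧ 0 < 3 * 2 ^ k - 1 := by
    have := Nat.one_le_two_pow (n := k)
    omega
  set ℓ := Real.log 3 / Real.log q with hℓ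
  have hℓ0 : 0 < ℓ := div_pos (Real.log_pos (by norm_num)) (Real.log_pos (by linarith))
  have hε : (0 : ℝ) < 1 / 3 * (1 / 2) ^ k := by positivity
  refine ⟨ENNReal.ofReal (1 / 3 * ℓ), ENNReal.ofReal ((1 / 3 + 1 / 3 * (1 / 2) ^ k) * ℓ),
    (ENNReal.ofReal_lt_ofReal_iff (by positivity)).2 (by gcongr; linarith), fun x ⟨hx1, hx2⟩ => ?_⟩
  have hx : ENNReal.ofReal x.toReal = x :=
    ENNReal.ofReal_toReal (hx2.trans_lt ENNReal.ofReal_lt_top).ne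
  rw [← hx, ENNReal.ofReal_le_ofReal_iff ENNReal.toReal_nonneg, ← le_div_iff₀ hℓ0] at hx1
  rw [← hx, ENNReal.ofReal_le_ofReal_iff (by positivity), ← div_le_iff₀ hℓ0] at hx2
  obtain ⟨y, hy, hyd⟩ := exists_isMorseBounded k (d := x.toReal / ℓ)
    (by rw [abs_le]; constructor <;> linarith)
  rw [← hN.1] at hy
  have h := ofReal_mem_Dset hq2 (by linarith)
    (hy.isUnivoque (by linarith) hN.2 (by linarith)) hyd
  rwa [← hℓ, div_mul_cancel₀ _ hℓ0.ne', hx] at h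

end
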